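/- (Verona–Verona) Let X be a real Banach space, let f : X → (−∞,+∞] be proper, lower semicontinuous and convex, and let B : X ⇉ X* be maximal monotone with dom B = X. Then ∂f + B is maximal monotone. -/

import Mathlib

open Set Filter Pointwise

noncomputable section

variable {X : Type*}

abbrev Dual' (X : Type*) [NormedAddCommGroup X] [NormedSpace ℝ X] := X →L[ℝ] ℝ

section Defs
variable [NormedAddCommGroup X] [NormedSpace ℝ X]

/-- `A` is a monotone operator. -/
def MonotoneOp (A : X → Set (Dual' X)) : Prop :=
  ∀ x y (x' y' : Dual' X), x' ∈ A x → y' ∈ A y → 0 ≤ (x' - y') (x - y)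

/-- `A` is maximal monotone: monotone, and every monotonically related pair is in the graph. -/
def MaxMonotone (A : X → Set (Dual' X)) : Prop :=
  MonotoneOp A ∧
    ∀ x (x' : Dual' X), (∀ y y', y' ∈ A y → 0 ≤ (x' - y') (x - y)) → x' ∈ A x

/-- domain of a set-valued operator -/
def domOp (A : X → Set (Dual' X)) : Set X := {x | (A x).Nonempty}

/-- pointwise Minkowski sum of two set-valued operators -/
def opSum (A B : X → Set (Dual' X)) : X → Set (Dual' X) := fun x => A x + B x

/-- normal cone operator of a set `C` -/
def normalCone (C : Set X) : X → Set (Dual' X) :=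
  fun x => {x' | x ∈ C ∧ ∀ c ∈ C, x' (c - x) ≤ 0}

/-- the Fitzpatrick function of `A` -/
def fitz (A : X → Set (Dual' X)) : X × Dual' X → EReal :=
  fun p => ⨆ q ∈ {q : X × Dual' X | q.2 ∈ A q.1},
    ((q.2 p.1 + p.2 q.1 - q.2 q.1 : ℝ) : EReal)

/-- `A` is maximal monotone of type (FPV) -/
def FPV (A : X → Set (Dual' X)) : Prop :=
  MaxMonotone A ∧
    ∀ U : Set X, IsOpen U → Convex ℝ U → (U ∩ domOp A).Nonempty →
      ∀ x (x' : Dual' X), x ∈ U →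
        (∀ y y', y' ∈ A y → y ∈ U → 0 ≤ (x' - y') (x - y)) → x' ∈ A x

/-- `A` is a linear relation: its graph is a linear subspace of `X × X*` -/
def LinearRel (A : X → Set (Dual' X)) : Prop :=
  (0 : Dual' X) ∈ A 0 ∧
  (∀ x y (x' y' : Dual' X), x' ∈ A x → y' ∈ A y → x' + y' ∈ A (x + y)) ∧
  (∀ (c : ℝ) x (x' : Dual' X), x' ∈ A x → c • x' ∈ A (c • x))

/-- subdifferential of an extended-real-valued function -/
def subdiff (f : X → EReal) : X → Set (Dual' X) :=
  fun x => {x' | ∀ y, ((x' (y - x) : ℝ) : EReal) + f x ≤ f y}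

/-- `f` is proper: never `⊥` and not identically `⊤` -/
def ProperFun (f : X → EReal) : Prop := (∀ x, f x ≠ ⊥) ∧ ∃ x, f x ≠ ⊤

/-- convexity for extended-real-valued functions -/
def EConvexOn (f : X → EReal) : Prop :=
  ∀ x y (t : ℝ), 0 ≤ t → t ≤ 1 →
    f (t • x + (1 - t) • y) ≤ (t : EReal) * f x + ((1 - t : ℝ) : EReal) * f y

/-- effective domain of an extended-real-valued function -/
def domFun (f : X → EReal) : Set X := {x | f x ≠ ⊤}

end Defs

section Auxiliary

open Topology

variable [NormedAddCommGroup X] [NormedSpace ℝ X]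

/-- Bishop–Phelps form of Ekeland's variational principle. -/
theorem exists_minimal_of_isClosed_of_bddBelow {Y : Type*} [NormedAddCommGroup Y] [CompleteSpace Y]
    {E : Set (Y × ℝ)} (hE : IsClosed E) {m : ℝ} (hm : ∀ p ∈ E, m ≤ p.2) {c : ℝ} (hc : 0 < c)
    {p₀ : Y × ℝ} (hp₀ : p₀ ∈ E) :
    ∃ p ∈ E, c * ‖p.1 - p₀.1‖ ≤ p₀.2 - p.2 ∧
      ∀ q ∈ E, c * ‖q.1 - p.1‖ ≤ p.2 - q.2 → q = p := by
  let D : Y × ℝ → Set (Y × ℝ) := fun p => {q | q ∈ E ∧ c * ‖q.1 - p.1‖ ≤ p.2 - q.2}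
  have hself : ∀ p ∈ E, p ∈ D p := fun p hp => ⟨hp, by simp⟩
  have htrans : ∀ p q r, q ∈ D p → r ∈ D q → r ∈ D p := by
    rintro p q r ⟨_, h1⟩ ⟨hr, h2⟩
    refine ⟨hr, ?_⟩
    have := norm_sub_le_norm_sub_add_norm_sub r.1 q.1 p.1
    nlinarith
  have hclosed : ∀ p, IsClosed (D p) := by
    intro p
    exact hE.inter (isClosed_le (f := fun q : Y × ℝ => c * ‖q.1 - p.1‖) (g := fun q => p.2 - q.2)
      (by fun_prop) (by fun_prop))
  have hnext : ∀ p : E, ∃ q : E, q.1 ∈ D p.1 ∧ ∀ r ∈ D p.1, 2 * q.1.2 - p.1.2 ≤ r.2 := by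
    rintro ⟨p, hp⟩
    have hbdd : BddBelow (Prod.snd '' D p) := ⟨m, by rintro _ ⟨q, hq, rfl⟩; exact hm q hq.1⟩
    have hle : sInf (Prod.snd '' D p) ≤ p.2 := csInf_le hbdd ⟨p, hself p hp, rfl⟩
    rcases hle.lt_or_eq with h | h
    · obtain ⟨_, ⟨q, hq, rfl⟩, hlt⟩ := exists_lt_of_csInf_lt
        (⟨p.2, p, hself p hp, rfl⟩ : (Prod.snd '' D p).Nonempty)
        (show sInf (Prod.snd '' D p) < (p.2 + sInf (Prod.snd '' D p)) / 2 by linarith)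
      refine ⟨⟨q, hq.1⟩, hq, fun r hr => ?_⟩
      have : sInf (Prod.snd '' D p) ≤ r.2 := csInf_le hbdd ⟨r, hr, rfl⟩
      dsimp only
      linarith
    · refine ⟨⟨p, hp⟩, hself p hp, fun r hr => ?_⟩
      have : sInf (Prod.snd '' D p) ≤ r.2 := csInf_le hbdd ⟨r, hr, rfl⟩
      dsimp only
      linarith
  choose nx hnx1 hnx2 using hnext
  let u : ℕ → E := fun n => nx^[n] ⟨p₀, hp₀⟩
  have hu : ∀ n, u (n + 1) = nx (u n) := fun n => Function.iterate_succ_apply' _ _ _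
  have hmem : ∀ n k, (u (n + k)).1 ∈ D (u n).1 := by
    intro n k
    induction k with
    | zero => exact hself _ (u n).2
    | succ k ih => exact htrans _ _ _ ih (by rw [← add_assoc, hu]; exact hnx1 _)
  have hanti : Antitone fun n => (u n).1.2 := by
    refine antitone_nat_of_succ_le fun n => ?_
    have := (hmem n 1).2
    have := mul_nonneg hc.le (norm_nonneg ((u (n + 1)).1.1 - (u n).1.1))
    linarith
  have hlim := tendsto_atTop_ciInf hanti ⟨m, by rintro _ ⟨n, rfl⟩; exact hm _ (u n).2⟩
  set L := ⨅ n, (u n).1.2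
  have hL : ∀ n, L ≤ (u n).1.2 := fun n => hanti.le_of_tendsto hlim n
  have hcauchy : CauchySeq fun n => (u n).1.1 := by
    refine cauchySeq_of_le_tendsto_0 (fun n => 2 * (((u n).1.2 - L) / c)) ?_ ?_
    · intro a b N ha hb
      obtain ⟨k, rfl⟩ := Nat.exists_eq_add_of_le ha
      obtain ⟨l, rfl⟩ := Nat.exists_eq_add_of_le hb
      have key : ∀ k, dist (u (N + k)).1.1 (u N).1.1 ≤ ((u N).1.2 - L) / c := by
        intro k
        rw [le_div_iff₀ hc, dist_eq_norm]
        have := (hmem N k).2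
        have := hL (N + k)
        linarith
      have := dist_triangle_right (u (N + k)).1.1 (u (N + l)).1.1 (u N).1.1
      have := key k
      have := key l
      linarith
    · have := ((hlim.sub_const L).div_const c).const_mul 2
      simpa using this
  obtain ⟨x, hx⟩ := cauchySeq_tendsto_of_complete hcauchy
  have hp : Tendsto (fun n => (u n).1) atTop (𝓝 (x, L)) := hx.prodMk_nhds hlim
  have hpD : ∀ n, (x, L) ∈ D (u n).1 := by
    intro n
    refine (hclosed _).mem_of_tendsto hp ?_
    filter_upwards [eventually_ge_atTop n] with k hk
    obtain ⟨l, rfl⟩ := Nat.exists_eq_add_of_le hk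
    exact hmem n l
  refine ⟨(x, L), (hpD 0).1, (hpD 0).2, fun q hq hqp => ?_⟩
  have hqL : L ≤ q.2 := by
    have h2 : Tendsto (fun n => 2 * (u (n + 1)).1.2 - (u n).1.2) atTop (𝓝 (2 * L - L)) :=
      (((tendsto_add_atTop_iff_nat 1).2 hlim).const_mul 2).sub hlim
    have : 2 * L - L ≤ q.2 := by
      refine le_of_tendsto' h2 fun n => ?_
      rw [hu]
      exact hnx2 _ _ (htrans _ _ _ (hpD n) ⟨hq, hqp⟩)
    linarith
  have h0 : c * ‖q.1 - x‖ ≤ 0 := hqp.trans (by simpa using hqL)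
  have h1 : ‖q.1 - x‖ = 0 := le_antisymm (by nlinarith) (norm_nonneg _)
  have h2 : q.2 = L := by
    have : c * ‖q.1 - x‖ ≤ L - q.2 := hqp
    rw [h1] at this
    linarith
  exact Prod.ext (sub_eq_zero.1 (norm_eq_zero.1 h1)) h2

/-- Sandwich theorem: an affine function between a convex set lying above the graph of `-k` and
that graph. -/
theorem exists_affine_between {E : Set (X × ℝ)} (hE : Convex ℝ E) (hne : E.Nonempty) {k : X → ℝ}
    (hk : ConvexOn ℝ univ k) (hkc : Continuous k) (h : ∀ p ∈ E, 0 ≤ p.2 + k p.1) :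
    ∃ (l : Dual' X) (a : ℝ), (∀ p ∈ E, l p.1 + a ≤ p.2) ∧ ∀ y, -k y ≤ l y + a := by
  let U : Set (X × ℝ) := {p | p.2 + k p.1 < 0}
  have hUo : IsOpen U := isOpen_lt (by fun_prop) continuous_const
  have hUc : Convex ℝ U := by
    rintro ⟨x, a⟩ hx ⟨y, b⟩ hy s t hs ht hst
    have h1 := hk.2 (mem_univ x) (mem_univ y) hs ht hst
    simp only [U, mem_ofPred_eq, smul_eq_mul, Prod.smul_mk, Prod.mk_add_mk] at *
    rcases hs.lt_or_eq with h0 | h0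
    · nlinarith
    · subst h0
      simp only [zero_add] at hst
      subst hst
      nlinarith
  have hdisj : Disjoint U E := by
    rw [Set.disjoint_left]
    intro p hp hp'
    exact absurd (h p hp') (not_le.2 hp)
  obtain ⟨F, s, hFU, hFE⟩ := geometric_hahn_banach_open hUc hUo hE hdisj
  set β := F (0, 1)
  set G : Dual' X := F.comp (ContinuousLinearMap.inl ℝ X ℝ)
  have hF : ∀ x b, F (x, b) = G x + b * β := by
    intro x b
    have : ((x, b) : X × ℝ) = (x, 0) + b • (0, 1) := by simp
    rw [this, map_add, map_smul]
    simp [G, β]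
  have hβ : 0 < β := by
    obtain ⟨⟨y, b⟩, hyb⟩ := hne
    have h1 := hFE _ hyb
    have h2 := hFU (y, -k y - 1) (by simp only [U, mem_ofPred_eq]; linarith)
    have h3 := h _ hyb
    rw [hF] at h1 h2
    dsimp only at h3
    nlinarith
  refine ⟨-(β⁻¹ • G), s / β, ?_, ?_⟩
  · rintro ⟨y, b⟩ hyb
    have h1 := hFE _ hyb
    rw [hF] at h1
    have : -(β⁻¹ • G) y + s / β = (s - G y) / β := by
      simp only [smul_apply, smul_eq_mul]; field_simp; ring
    simp only [neg_apply]
    rw [this, div_le_iff₀ hβ]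
    linarith
  · intro y
    have : (-(β⁻¹ • G)) y + s / β = (s - G y) / β := by
      simp only [neg_apply, smul_apply, smul_eq_mul]
      field_simp; ring
    rw [this, le_div_iff₀ hβ]
    refine le_of_forall_pos_le_add fun ε hε => ?_
    have h2 := hFU (y, -k y - ε / β) (by
      simp only [U, mem_ofPred_eq]
      have := div_pos hε hβ
      linarith)
    rw [hF] at h2
    have : ε / β * β = ε := by field_simp
    nlinarith

/-- A closed convex set has an affine minorant if it contains some point but not every point below
it on the same vertical line. -/
theorem exists_affine_minorant {E : Set (X × ℝ)} (hE : Convex ℝ E) (hcl : IsClosed E) {x : X}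
    {a t : ℝ} (hxa : (x, a) ∈ E) (hxt : (x, t) ∉ E) (hta : t < a) :
    ∃ (l : Dual' X) (c : ℝ), ∀ p ∈ E, l p.1 + c ≤ p.2 := by
  obtain ⟨F, s, hFx, hFE⟩ := geometric_hahn_banach_point_closed hE hcl hxt
  set β := F (0, 1)
  set G : Dual' X := F.comp (ContinuousLinearMap.inl ℝ X ℝ)
  have hF : ∀ x b, F (x, b) = G x + b * β := by
    intro x b
    have : ((x, b) : X × ℝ) = (x, 0) + b • (0, 1) := by simp
    rw [this, map_add, map_smul]
    simp [G, β]
  have hβ : 0 < β := by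
    have h1 := hFE _ hxa
    rw [hF] at h1 hFx
    nlinarith
  refine ⟨-(β⁻¹ • G), s / β, ?_⟩
  rintro ⟨y, b⟩ hyb
  have h1 := hFE _ hyb
  rw [hF] at h1
  have : -(β⁻¹ • G) y + s / β = (s - G y) / β := by
    simp only [smul_apply, smul_eq_mul]; field_simp; ring
  simp only [neg_apply]
  rw [this, div_le_iff₀ hβ]
  linarith

theorem convexOn_infDist {S : Set X} (hS : Convex ℝ S) (hne : S.Nonempty) (hc : IsCompact S) :
    ConvexOn ℝ univ fun y => Metric.infDist y S := by
  refine ⟨convex_univ, ?_⟩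
  intro x _ y _ s t hs ht hst
  obtain ⟨p, hp, hxp⟩ := hc.exists_infDist_eq_dist hne x
  obtain ⟨q, hq, hyq⟩ := hc.exists_infDist_eq_dist hne y
  have h1 := Metric.infDist_le_dist_of_mem (x := s • x + t • y) (hS hp hq hs ht hst)
  have h2 : dist (s • x + t • y) (s • p + t • q) ≤ s * dist x p + t * dist y q := by
    calc _ ≤ dist (s • x) (s • p) + dist (t • y) (t • q) := dist_add_add_le _ _ _ _
      _ = _ := by rw [dist_smul₀, dist_smul₀, Real.norm_of_nonneg hs, Real.norm_of_nonneg ht]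
  simp only [hxp, hyq, smul_eq_mul]
  linarith

/-- A monotone operator whose domain is a Banach space is locally bounded. -/
theorem MonotoneOp.exists_bound [CompleteSpace X] {B : X → Set (Dual' X)} (hB : MonotoneOp B)
    (hfull : domOp B = univ) (c : X) :
    ∃ r > 0, ∃ M : ℝ, ∀ y, ‖y - c‖ ≤ r → ∀ b ∈ B y, ‖b‖ ≤ M := by
  let C : ℕ → Set X := fun n =>
    ⋂ (y : X) (b : Dual' X) (_ : b ∈ B y) (_ : ‖y - c‖ ≤ 1), {x | b (c + x - y) ≤ n}
  have hCmem : ∀ n x, x ∈ C n ↔ ∀ y, ∀ b ∈ B y, ‖y - c‖ ≤ 1 → b (c + x - y) ≤ n := by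
    intro n x
    simp only [C, mem_iInter, mem_ofPred_eq]
  have hCcl : ∀ n, IsClosed (C n) := fun n =>
    isClosed_iInter fun y => isClosed_iInter fun b => isClosed_iInter fun _ =>
      isClosed_iInter fun _ => isClosed_le (by fun_prop) continuous_const
  have hCx : ∀ x, ∃ n, x ∈ C n := by
    intro x
    obtain ⟨d, hd⟩ : (B (c + x)).Nonempty := by
      have : c + x ∈ domOp B := hfull ▸ mem_univ _
      exact this
    obtain ⟨n, hn⟩ := exists_nat_ge (‖d‖ * (‖x‖ + 1))
    refine ⟨n, (hCmem n x).2 fun y b hb hy => ?_⟩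
    have h1 := hB _ _ _ _ hd hb
    rw [sub_apply] at h1
    have h2 := (le_abs_self _).trans (d.le_opNorm (c + x - y))
    have h3 : ‖c + x - y‖ ≤ ‖x‖ + 1 := by
      have : c + x - y = x - (y - c) := by abel
      rw [this]
      exact (norm_sub_le _ _).trans (by linarith)
    have := mul_le_mul_of_nonneg_left h3 (norm_nonneg d)
    linarith
  obtain ⟨n, u, hu⟩ := nonempty_interior_of_iUnion_of_closed hCcl
    (eq_univ_of_forall fun x => mem_iUnion.2 (hCx x))
  obtain ⟨ρ, hρ, hball⟩ := Metric.isOpen_iff.1 isOpen_interior u hu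
  obtain ⟨m, hm⟩ := hCx (-u)
  have hK : ∀ v, ‖v‖ < ρ / 2 → ∀ y, ∀ b ∈ B y, ‖y - c‖ ≤ 1 →
      b (c + v - y) ≤ ((n : ℝ) + m) / 2 := by
    intro v hv y b hb hy
    have h1 : u + (2 : ℝ) • v ∈ C n := by
      refine interior_subset (hball ?_)
      rw [Metric.mem_ball, dist_eq_norm, add_sub_cancel_left, norm_smul]
      norm_num
      linarith
    have h2 := (hCmem _ _).1 h1 y b hb hy
    have h3 := (hCmem _ _).1 hm y b hb hy
    simp only [map_add, map_sub, map_neg, map_smul, smul_eq_mul] at h2 h3 ⊢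
    linarith
  set r := min 1 (ρ / 8)
  have hr : 0 < r := by positivity
  have hr1 : r ≤ 1 := min_le_left _ _
  have hr2 : r ≤ ρ / 8 := min_le_right _ _
  refine ⟨r, hr, ((n : ℝ) + m) / 2 / (ρ / 4), fun y hy b hb => ?_⟩
  have hbd : ∀ w, ‖w‖ ≤ ρ / 4 → b w ≤ ((n : ℝ) + m) / 2 := by
    intro w hw
    have h1 : ‖(y - c) + w‖ < ρ / 2 := (norm_add_le _ _).trans_lt (by linarith)
    have := hK _ h1 y b hb (by linarith)
    rwa [show c + (y - c + w) - y = w by abel] at this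
  have hbd' : ∀ w, b w ≤ ((n : ℝ) + m) / 2 / (ρ / 4) * ‖w‖ := by
    intro w
    rcases (norm_nonneg w).eq_or_lt with h0 | h0
    · simp [norm_eq_zero.1 h0.symm]
    · have h1 := hbd ((ρ / 4 / ‖w‖) • w) (by
        rw [norm_smul, Real.norm_of_nonneg (by positivity), div_mul_cancel₀ _ h0.ne'])
      rw [map_smul, smul_eq_mul] at h1
      calc b w = (ρ / 4 / ‖w‖ * b w) * (‖w‖ / (ρ / 4)) := by field_simp
        _ ≤ ((n : ℝ) + m) / 2 * (‖w‖ / (ρ / 4)) := by gcongr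
        _ = _ := by ring
  refine b.opNorm_le_bound (by positivity) fun w => abs_le'.2 ⟨hbd' w, ?_⟩
  have := hbd' (-w)
  rwa [map_neg, norm_neg] at this

/-- Approximate mean value theorem for a closed convex epigraph `E`: if the value at `x` is smaller
than the value at `0`, there are subgradients almost pointing away from `0` at points close to some
point of the segment `(0, x]`. -/
theorem exists_subgradient_near_segment [CompleteSpace X] {E : Set (X × ℝ)} (hE : Convex ℝ E)
    (hcl : IsClosed E) (hmin : ∃ (l : Dual' X) (c : ℝ), ∀ p ∈ E, l p.1 + c ≤ p.2) {x : X} {r : ℝ}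
    (hx : (x, r) ∈ E) (h0 : ∀ b, ((0 : X), b) ∈ E → r < b) :
    ∃ s : ℝ, 0 < s ∧ s ≤ 1 ∧ ∀ ε > 0, ∃ (z : X) (a : ℝ) (l : Dual' X), (z, a) ∈ E ∧
      (∀ p ∈ E, a + l (p.1 - z) ≤ p.2) ∧ ‖z - s • x‖ ≤ ε ∧ l z ≤ ε := by
  obtain ⟨l₀, c₀, hl₀⟩ := hmin
  let M : Set ℝ := Prod.snd '' {p : Icc (0 : ℝ) 1 × ℝ | (p.1.1 • x, p.2) ∈ E}
  have hMcl : IsClosed M :=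
    isClosedMap_snd_of_compactSpace _ (hcl.preimage (by fun_prop))
  have hMne : M.Nonempty := ⟨r, (⟨1, by simp⟩, r), by simpa using hx, rfl⟩
  set K := ‖l₀‖ * ‖x‖ - c₀
  have hMbd : BddBelow M := by
    refine ⟨-K, ?_⟩
    rintro _ ⟨⟨⟨s, hs0, hs1⟩, b⟩, hb, rfl⟩
    have h1 := hl₀ _ hb
    have h2 := neg_le_of_abs_le (l₀.le_opNorm (s • x))
    have h3 : ‖s • x‖ ≤ ‖x‖ := by
      rw [norm_smul, Real.norm_of_nonneg hs0]
      exact mul_le_of_le_one_left (norm_nonneg _) hs1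
    have h4 := mul_le_mul_of_nonneg_left h3 (norm_nonneg l₀)
    simp only [K] at h1 ⊢
    linarith
  obtain ⟨⟨⟨s, hs0, hs1⟩, γ⟩, hγE, hγ⟩ := hMcl.csInf_mem hMne hMbd
  dsimp only at hγ
  have hγmin : ∀ t : ℝ, 0 ≤ t → t ≤ 1 → ∀ b, (t • x, b) ∈ E → γ ≤ b := by
    intro t ht0 ht1 b hb
    rw [hγ]
    exact csInf_le hMbd ⟨(⟨t, ht0, ht1⟩, b), hb, rfl⟩
  change (s • x, γ) ∈ E at hγE
  have hspos : 0 < s := by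
    refine hs0.lt_of_ne ?_
    rintro rfl
    have h1 := h0 γ (by simpa using hγE)
    have h2 := hγmin 1 zero_le_one le_rfl r (by simpa using hx)
    linarith
  refine ⟨s, hspos, hs1, fun ε hε => ?_⟩
  let S : Set X := (fun t : ℝ => t • x) '' Icc (0 : ℝ) 1
  have hSc : IsCompact S := isCompact_Icc.image (by fun_prop)
  have hSne : S.Nonempty := ⟨_, 0, by simp, rfl⟩
  have hSconv : Convex ℝ S :=
    (convex_Icc (0 : ℝ) 1).linear_image (LinearMap.toSpanSingleton ℝ X x)
  have h0S : (0 : X) ∈ S := ⟨0, by simp, by simp⟩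
  have hsS : s • x ∈ S := ⟨s, ⟨hs0, hs1⟩, rfl⟩
  set c := min 1 ε / (‖x‖ + 1)
  have hxpos : 0 < ‖x‖ + 1 := by positivity
  have hc : 0 < c := by positivity
  have hcmul : c * (‖x‖ + 1) = min 1 ε := by simp only [c]; field_simp
  have hcle : c ≤ min 1 ε := by
    rw [← hcmul]; exact le_mul_of_one_le_right hc.le (by linarith [norm_nonneg x])
  set η := c * c
  have hη : 0 < η := by positivity
  obtain ⟨n, hn0, hn⟩ : ∃ n : ℝ, 0 ≤ n ∧ ∀ p ∈ E, γ - η ≤ p.2 + n * Metric.infDist p.1 S := by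
    have hlow : ∀ p ∈ E, -K - ‖l₀‖ * Metric.infDist p.1 S ≤ p.2 := by
      intro p hp
      obtain ⟨_, ⟨t, ⟨ht0, ht1⟩, rfl⟩, hq⟩ := hSc.exists_infDist_eq_dist hSne p.1
      have h1 := hl₀ _ hp
      have h2 := neg_le_of_abs_le (l₀.le_opNorm p.1)
      have h3 : ‖t • x‖ ≤ ‖x‖ := by
        rw [norm_smul, Real.norm_of_nonneg ht0]
        exact mul_le_of_le_one_left (norm_nonneg _) ht1
      have h4 : ‖p.1‖ ≤ dist p.1 (t • x) + ‖t • x‖ := by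
        rw [dist_eq_norm]
        exact norm_le_norm_sub_add p.1 (t • x)
      rw [hq]
      have h5 := mul_le_mul_of_nonneg_left (h4.trans (add_le_add_right h3 _)) (norm_nonneg l₀)
      rw [mul_add] at h5
      simp only [K]
      linarith
    let T : Set (X × ℝ) := S ×ˢ Icc (-K - ‖l₀‖) (γ - η)
    have hTc : IsCompact T := hSc.prod isCompact_Icc
    have hdisj : Disjoint T E := by
      rw [Set.disjoint_left]
      rintro ⟨_, b⟩ ⟨⟨t, ⟨ht0, ht1⟩, rfl⟩, hb⟩ hE'
      have := hγmin t ht0 ht1 b hE'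
      have := hb.2
      dsimp only at this
      linarith
    obtain ⟨δ, hδ, hthick⟩ := hdisj.exists_thickenings hTc hcl
    have hfar : ∀ p ∈ E, Metric.infDist p.1 S < min 1 δ → γ - η ≤ p.2 := by
      intro p hp hd
      by_contra hlt
      push Not at hlt
      obtain ⟨q, hqS, hq⟩ := hSc.exists_infDist_eq_dist hSne p.1
      refine Set.disjoint_left.1 hthick
        (Metric.mem_thickening_iff.2 ⟨(q, p.2), ⟨hqS, ?_, hlt.le⟩, ?_⟩)
        (Metric.self_subset_thickening hδ E hp)
      · have h1 := hlow p hp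
        have h2 := mul_le_mul_of_nonneg_left (hd.le.trans (min_le_left _ _)) (norm_nonneg l₀)
        dsimp only
        linarith
      · rw [Prod.dist_eq]
        simp only [dist_self]
        rw [← hq]
        exact max_lt (hd.trans_le (min_le_right _ _)) hδ
    have hδ' : 0 < min 1 δ := lt_min one_pos hδ
    refine ⟨‖l₀‖ + |γ + K| / min 1 δ, by positivity, fun p hp => ?_⟩
    have hd0 : 0 ≤ Metric.infDist p.1 S := Metric.infDist_nonneg
    rcases lt_or_ge (Metric.infDist p.1 S) (min 1 δ) with h | h
    · have := hfar p hp h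
      have : 0 ≤ (‖l₀‖ + |γ + K| / min 1 δ) * Metric.infDist p.1 S := by positivity
      linarith
    · have h1 := hlow p hp
      have h2 : |γ + K| ≤ |γ + K| / min 1 δ * Metric.infDist p.1 S := by
        rw [div_mul_eq_mul_div, le_div_iff₀ hδ']
        exact mul_le_mul_of_nonneg_left h (abs_nonneg _)
      have h3 := le_abs_self (γ + K)
      rw [add_mul]
      linarith
  let E' : Set (X × ℝ) := {p | (p.1, p.2 - n * Metric.infDist p.1 S) ∈ E}
  have hinf : Continuous fun y : X => Metric.infDist y S := Metric.continuous_infDist_pt S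
  have hE'cl : IsClosed E' := hcl.preimage (by fun_prop)
  obtain ⟨⟨z, t⟩, hzE, hz1, hz2⟩ := exists_minimal_of_isClosed_of_bddBelow (m := γ - η) hE'cl
    (fun p hp => by simpa using hn _ hp) hc (p₀ := (s • x, γ))
    (by simpa [E', Metric.infDist_zero_of_mem hsS] using hγE)
  have hEk : ∀ y b, (y, b) ∈ E → t ≤ b + n * Metric.infDist y S + c * ‖y - z‖ := by
    intro y b hyb
    by_contra! hlt
    have := hz2 (y, b + n * Metric.infDist y S) (by simpa [E'] using hyb) (by
      dsimp only
      linarith)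
    rw [Prod.mk.injEq] at this
    obtain ⟨rfl, h2⟩ := this
    simp only [sub_self, norm_zero, mul_zero] at hlt
    linarith
  have hkconv : ConvexOn ℝ univ fun y => n * Metric.infDist y S + c * ‖y - z‖ + (-t) := by
    refine ConvexOn.add_const (ConvexOn.add ?_ ?_) _
    · simpa using (convexOn_infDist hSconv hSne hSc).smul hn0
    · simpa [dist_eq_norm] using (convexOn_dist z (convex_univ (𝕜 := ℝ))).smul hc.le
  obtain ⟨l, a, hla, hlk⟩ := exists_affine_between hE ⟨_, hx⟩ hkconv (by fun_prop) (by
    rintro ⟨y, b⟩ hp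
    have := hEk y b hp
    dsimp only
    linarith)
  have hzE' : (z, t - n * Metric.infDist z S) ∈ E := hzE
  have hdz : 0 ≤ n * Metric.infDist z S := mul_nonneg hn0 Metric.infDist_nonneg
  have ht1 := hla _ hzE'
  have ht2 := hlk z
  have ht3 := hlk 0
  have hzγ : γ - η ≤ t := by simpa using hn _ hzE'
  have hzc : ‖z - s • x‖ ≤ c := by
    have : c * ‖z - s • x‖ ≤ c * c := hz1.trans (by dsimp only; linarith)
    exact le_of_mul_le_mul_left this hc
  refine ⟨z, t - n * Metric.infDist z S, l, hzE', ?_, hzc.trans (hcle.trans (min_le_right _ _)), ?_⟩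
  · rintro ⟨y, b⟩ hp
    have := hla _ hp
    simp only [sub_self, norm_zero, mul_zero] at ht2
    rw [map_sub]
    dsimp only at this ⊢
    linarith
  · simp only [map_zero, Metric.infDist_zero_of_mem h0S, zero_sub, norm_neg, mul_zero] at ht3
    dsimp only at ht1
    have hznorm : ‖z‖ ≤ ‖x‖ + 1 := by
      have h1 := norm_le_norm_sub_add z (s • x)
      have h3 : ‖s • x‖ ≤ ‖x‖ := by
        rw [norm_smul, Real.norm_of_nonneg hs0]
        exact mul_le_of_le_one_left (norm_nonneg _) hs1
      have := hcle.trans (min_le_left 1 ε)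
      linarith
    have h4 := mul_le_mul_of_nonneg_left hznorm hc.le
    rw [hcmul] at h4
    have := min_le_right 1 ε
    linarith

theorem MaxMonotone.exists_mem_zero_of_ray [CompleteSpace X] {B : X → Set (Dual' X)}
    (hB : MaxMonotone B) (hfull : domOp B = univ) (y : X) (v : ℝ)
    (h : ∀ t : ℝ, 0 < t → t < 1 → ∀ b ∈ B (t • y), v ≤ b y) : ∃ b ∈ B 0, v ≤ b y := by
  obtain ⟨r, hr, M, hM⟩ := hB.1.exists_bound hfull 0
  have hne : ∀ x, (B x).Nonempty := fun x => (hfull ▸ mem_univ x : x ∈ domOp B)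
  choose β hβ using hne
  let t : ℕ → ℝ := fun n => 1 / ((n : ℝ) + 1)
  have ht0 : ∀ n, 0 < t n := fun n => by positivity
  have ht : Tendsto t atTop (𝓝 0) := tendsto_one_div_add_atTop_nhds_zero_nat
  have hty : Tendsto (fun n => t n • y) atTop (𝓝 0) := by simpa using ht.smul_const y
  have hev : ∀ᶠ n in atTop, t n < 1 ∧ ‖t n • y‖ < r :=
    (ht.eventually (gt_mem_nhds one_pos)).and
      (hty.norm.eventually (gt_mem_nhds (by simpa using hr)))
  let 𝒰 : Ultrafilter ℕ := hyperfilter ℕ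
  have hle : (𝒰 : Filter ℕ) ≤ atTop := Nat.hyperfilter_le_atTop
  let u : ℕ → WeakDual ℝ X := fun n => StrongDual.toWeakDual (β (t n • y))
  have hu : ∀ᶠ n in (𝒰 : Filter ℕ),
      u n ∈ WeakDual.toStrongDual ⁻¹' Metric.closedBall (0 : StrongDual ℝ X) M := by
    filter_upwards [hle hev] with n hn
    simpa [u] using hM (t n • y) (by simpa using hn.2.le) _ (hβ _)
  obtain ⟨b, -, hb⟩ := (WeakDual.isCompact_closedBall (0 : StrongDual ℝ X) M).ultrafilter_le_nhds
    (𝒰.map u) (le_principal_iff.2 hu)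
  have heval : ∀ w, Tendsto (fun n => β (t n • y) w) 𝒰 (𝓝 (b w)) := fun w =>
    ((WeakDual.eval_continuous w).tendsto b).comp hb
  refine ⟨WeakDual.toStrongDual b, hB.2 _ _ fun w w' hw => ?_, ?_⟩
  · have hlim : Tendsto (fun n => t n * β (t n • y) y - β (t n • y) w - (w' (t n • y) - w' w)) 𝒰
        (𝓝 (0 * b y - b w - (w' 0 - w' w))) :=
      (((ht.mono_left hle).mul (heval y)).sub (heval w)).sub
        (((w'.continuous.tendsto 0).comp (hty.mono_left hle)).sub_const _)
    have h1 : 0 ≤ 0 * b y - b w - (w' 0 - w' w) := by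
      refine ge_of_tendsto' hlim fun n => ?_
      have h2 := hB.1 _ _ _ _ (hβ (t n • y)) hw
      rw [sub_apply, map_sub, map_sub, map_smul (β _), smul_eq_mul] at h2
      exact h2
    rw [sub_apply, map_sub, map_sub]
    simpa using h1
  · refine ge_of_tendsto (heval y) ?_
    filter_upwards [hle hev] with n hn
    exact h _ (ht0 n) hn.1 _ (hβ _)

section Epigraph

variable [CompleteSpace X] {E : Set (X × ℝ)} {B : X → Set (Dual' X)}

theorem le_add_of_monotonically_related (hE : Convex ℝ E) (hcl : IsClosed E)
    (hmin : ∃ (l : Dual' X) (c : ℝ), ∀ p ∈ E, l p.1 + c ≤ p.2) (hB : MonotoneOp B)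
    (hfull : domOp B = univ)
    (hrel : ∀ z a (l : Dual' X), (z, a) ∈ E → (∀ p ∈ E, a + l (p.1 - z) ≤ p.2) →
      ∀ b ∈ B z, 0 ≤ (l + b) z)
    {x : X} {a : ℝ} (hx : (x, a) ∈ E) {b : Dual' X} (hb : b ∈ B ((2 : ℝ) • x)) {r : ℝ}
    (hr : ∀ t, ((0 : X), t) ∈ E → r < t) : r ≤ a + b x := by
  by_contra! hlt
  have hx0 : ‖x‖ ≠ 0 := by
    intro h
    obtain rfl := norm_eq_zero.1 h
    have := hr a hx
    simp only [map_zero, add_zero] at hlt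
    linarith
  obtain ⟨g, -, hg⟩ := exists_dual_vector ℝ x hx0
  let l₀ : Dual' X := ((a - r) / ‖x‖) • g
  have hl₀ : l₀ x = a - r := by
    change (a - r) / ‖x‖ * g x = a - r
    rw [hg]
    simp [hx0]
  let φ : X × ℝ →L[ℝ] X × ℝ := (ContinuousLinearMap.fst ℝ X ℝ).prod
    (ContinuousLinearMap.snd ℝ X ℝ + l₀.comp (ContinuousLinearMap.fst ℝ X ℝ))
  have hφ : ∀ p, p ∈ φ ⁻¹' E ↔ (p.1, p.2 + l₀ p.1) ∈ E := fun p => Iff.rfl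
  obtain ⟨l₁, c₁, hl₁⟩ := hmin
  obtain ⟨s, hs0, hs1, hs⟩ := exists_subgradient_near_segment (E := φ ⁻¹' E) (x := x) (r := r)
    (hE.is_linear_preimage φ.toLinearMap.isLinear) (hcl.preimage φ.continuous)
    ⟨l₁ - l₀, c₁, fun p hp => by
      have := hl₁ _ hp
      change l₁ p.1 + c₁ ≤ p.2 + l₀ p.1 at this
      rw [sub_apply]
      linarith⟩
    (by rw [hφ, hl₀]; simpa using hx)
    (fun t ht => hr t (by simpa using (hφ _).1 ht))
  obtain ⟨ρ, hρ, M, hM⟩ := hB.exists_bound hfull (s • x)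
  have key : ∀ ε > 0, ε ≤ ρ → 0 ≤ s * (a + b x - r) + ε * (1 + ‖l₀‖ + (‖b‖ + |M|) + |M|) := by
    intro ε hε hερ
    obtain ⟨z, a', l, hz, hl, hzs, hlz⟩ := hs ε hε
    obtain ⟨d, hd⟩ : (B z).Nonempty := (hfull ▸ mem_univ z : z ∈ domOp B)
    have hdM : ‖d‖ ≤ |M| := (hM z (hzs.trans hερ) d hd).trans (le_abs_self M)
    have h1 := hrel z (a' + l₀ z) (l + l₀) hz (by
      intro p hp
      have := hl (p.1, p.2 - l₀ p.1) (by rw [hφ]; simpa using hp)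
      rw [add_apply, map_sub l₀]
      dsimp only at this
      linarith) d hd
    have h2 := hB _ _ _ _ hb hd
    obtain ⟨e, rfl⟩ : ∃ e, z = s • x + e := ⟨z - s • x, by abel⟩
    rw [add_sub_cancel_left] at hzs
    have bound : ∀ f : Dual' X, |f e| ≤ ‖f‖ * ε := fun f =>
      (f.le_opNorm e).trans (mul_le_mul_of_nonneg_left hzs (norm_nonneg f))
    have hl₀e := (le_abs_self _).trans (bound l₀)
    have hbe := neg_le_of_abs_le (bound b)
    have hde : |d e| ≤ |M| * ε := (bound d).trans (mul_le_mul_of_nonneg_right hdM hε.le)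
    have hde' := (le_abs_self _).trans hde
    simp only [add_apply, sub_apply, map_add, map_sub, map_smul, smul_eq_mul, hl₀] at h1 h2 hlz
    have h3 : d x ≤ b x + ε * (‖b‖ + |M|) := by
      by_contra! hlt'
      have h5 : 0 ≤ ε * (‖b‖ + |M|) := by positivity
      nlinarith
    have h4 : s * d x ≤ s * b x + ε * (‖b‖ + |M|) := by
      have h5 : 0 ≤ ε * (‖b‖ + |M|) := by positivity
      nlinarith
    nlinarith
  set K := 1 + ‖l₀‖ + (‖b‖ + |M|) + |M|
  have hK : 0 < K := by positivity
  have hδ : 0 < s * (r - a - b x) := mul_pos hs0 (by linarith)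
  have h1 := key (min ρ (s * (r - a - b x) / (2 * K))) (by positivity) (min_le_left _ _)
  have h2 : min ρ (s * (r - a - b x) / (2 * K)) * K ≤ s * (r - a - b x) / 2 := by
    calc _ ≤ s * (r - a - b x) / (2 * K) * K := by gcongr; exact min_le_right _ _
      _ = _ := by field_simp
  nlinarith

theorem exists_subgradient_zero_of_monotonically_related (hE : Convex ℝ E) (hcl : IsClosed E)
    (hne : E.Nonempty) (hmin : ∃ (l : Dual' X) (c : ℝ), ∀ p ∈ E, l p.1 + c ≤ p.2)
    (hB : MaxMonotone B) (hfull : domOp B = univ)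
    (hrel : ∀ z a (l : Dual' X), (z, a) ∈ E → (∀ p ∈ E, a + l (p.1 - z) ≤ p.2) →
      ∀ b ∈ B z, 0 ≤ (l + b) z) :
    ∃ (a : ℝ) (b : Dual' X), ((0 : X), a) ∈ E ∧ b ∈ B 0 ∧ ∀ p ∈ E, a - b p.1 ≤ p.2 := by
  have hBne : ∀ x, (B x).Nonempty := fun x => (hfull ▸ mem_univ x : x ∈ domOp B)
  let S : Set ℝ := {t | ((0 : X), t) ∈ E}
  have hScl : IsClosed S := hcl.preimage (by fun_prop)
  have hSne : S.Nonempty := by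
    by_contra hS
    rw [Set.not_nonempty_iff_eq_empty] at hS
    obtain ⟨⟨x, a⟩, hx⟩ := hne
    obtain ⟨b, hb⟩ := hBne ((2 : ℝ) • x)
    have := le_add_of_monotonically_related hE hcl hmin hB.1 hfull hrel hx hb (r := a + b x + 1)
      fun t ht => (hS ▸ ht : t ∈ (∅ : Set ℝ)).elim
    linarith
  have hSbd : BddBelow S := by
    obtain ⟨l, c, hl⟩ := hmin
    exact ⟨c, fun t ht => by simpa using hl _ ht⟩
  set a₀ := sInf S
  have ha₀ : ((0 : X), a₀) ∈ E := hScl.csInf_mem hSne hSbd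
  have hray : ∀ x a, (x, a) ∈ E → ∀ b ∈ B ((2 : ℝ) • x), a₀ ≤ a + b x := by
    intro x a hx b hb
    refine le_of_forall_lt fun r hr => ?_
    obtain ⟨r', hr1, hr2⟩ := exists_between hr
    exact hr1.trans_le (le_add_of_monotonically_related hE hcl hmin hB.1 hfull hrel hx hb
      fun t ht => hr2.trans_le (csInf_le hSbd ht))
  have hpt : ∀ p ∈ E, ∃ b ∈ B 0, a₀ - p.2 ≤ b p.1 := by
    rintro ⟨y, a⟩ hp
    refine hB.exists_mem_zero_of_ray hfull y _ fun t ht0 ht1 b hb => ?_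
    have h1 := hE hp ha₀ (a := t / 2) (b := 1 - t / 2) (by linarith) (by linarith) (by ring)
    simp only [Prod.smul_mk, Prod.mk_add_mk, smul_zero, add_zero, smul_eq_mul] at h1
    have h2 := hray _ _ h1 b (by rwa [smul_smul, show 2 * (t / 2) = t by ring])
    rw [map_smul, smul_eq_mul] at h2
    dsimp only
    nlinarith
  obtain ⟨r, hr, M, hM⟩ := hB.1.exists_bound hfull 0
  have hM0 : ∀ b ∈ B 0, ‖b‖ ≤ M := hM 0 (by simpa using hr.le)
  obtain ⟨b₀, hb₀⟩ := hBne 0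
  have hMnn : 0 ≤ M := (norm_nonneg b₀).trans (hM0 b₀ hb₀)
  have hle : ∀ b ∈ B 0, ∀ w, b w ≤ M * ‖w‖ := fun b hb w =>
    (le_abs_self _).trans ((b.le_opNorm w).trans
      (mul_le_mul_of_nonneg_right (hM0 b hb) (norm_nonneg w)))
  let φ : X → ℝ := fun w => sSup ((fun b : Dual' X => b w) '' B 0)
  have hφ_ge : ∀ b ∈ B 0, ∀ w, b w ≤ φ w := fun b hb w =>
    le_csSup ⟨M * ‖w‖, by rintro _ ⟨d, hd, rfl⟩; exact hle d hd w⟩ ⟨b, hb, rfl⟩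
  have hφ_le : ∀ w c, (∀ b ∈ B 0, b w ≤ c) → φ w ≤ c := fun w c h =>
    csSup_le ⟨_, b₀, hb₀, rfl⟩ (by rintro _ ⟨d, hd, rfl⟩; exact h d hd)
  have hφ_zero : φ 0 = 0 :=
    le_antisymm (hφ_le 0 0 fun b _ => by simp) (by simpa using hφ_ge b₀ hb₀ 0)
  have hφ_conv : ConvexOn ℝ univ φ := by
    refine ⟨convex_univ, fun x _ y _ s t hs ht _ => hφ_le _ _ fun b hb => ?_⟩
    simp only [map_add, map_smul, smul_eq_mul]
    exact add_le_add (mul_le_mul_of_nonneg_left (hφ_ge b hb x) hs)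
      (mul_le_mul_of_nonneg_left (hφ_ge b hb y) ht)
  have hφ_cont : Continuous φ := by
    refine (LipschitzWith.of_le_add_mul ⟨M, hMnn⟩ fun x y => hφ_le _ _ fun b hb => ?_).continuous
    have h1 := hle b hb (x - y)
    have h2 := hφ_ge b hb y
    rw [map_sub] at h1
    rw [dist_eq_norm]
    change b x ≤ φ y + M * ‖x - y‖
    linarith
  obtain ⟨l, c, hl, hlφ⟩ := exists_affine_between hE hne (hφ_conv.add_const (-a₀))
    (hφ_cont.add continuous_const) (by
      intro p hp
      obtain ⟨b, hb, h⟩ := hpt p hp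
      have := hφ_ge b hb p.1
      dsimp only [Pi.add_apply]
      linarith)
  dsimp only [Pi.add_apply] at hlφ
  have hc : c = a₀ := by
    have h1 := hl _ ha₀
    have h2 := hlφ 0
    simp only [map_zero, hφ_zero] at h1 h2
    linarith
  subst hc
  refine ⟨_, -l, ha₀, hB.2 _ _ fun y y' hy => ?_, fun p hp => ?_⟩
  · have h1 := hlφ y
    have h2 : φ y ≤ y' y := hφ_le _ _ fun b hb => by
      have := hB.1 _ _ _ _ hb hy
      simp only [zero_sub, map_neg, sub_apply] at this
      linarith
    simp only [zero_sub, map_neg, sub_apply, neg_apply]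
    linarith
  · have := hl p hp
    rw [neg_apply]
    linarith

end Epigraph

theorem monotoneOp_subdiff {f : X → EReal} (hf : ProperFun f) : MonotoneOp (subdiff f) := by
  obtain ⟨hbot, w, hw⟩ := hf
  have hfin : ∀ x (x' : Dual' X), x' ∈ subdiff f x → ∃ r : ℝ, f x = r := by
    intro x x' hx
    refine ⟨(f x).toReal, (EReal.coe_toReal (fun htop => ?_) (hbot x)).symm⟩
    have := hx w
    rw [htop, EReal.coe_add_top, top_le_iff] at this
    exact hw this
  intro x y x' y' hx hy
  obtain ⟨r, hr⟩ := hfin x x' hx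
  obtain ⟨s, hs⟩ := hfin y y' hy
  have h1 := hx y
  have h2 := hy x
  rw [hr, hs, ← EReal.coe_add, EReal.coe_le_coe_iff] at h1 h2
  simp only [map_sub, sub_apply] at *
  linarith

theorem MonotoneOp.opSum {A B : X → Set (Dual' X)} (hA : MonotoneOp A) (hB : MonotoneOp B) :
    MonotoneOp (opSum A B) := by
  rintro x y _ _ ⟨a, ha, b, hb, rfl⟩ ⟨c, hc, d, hd, rfl⟩
  have h1 := hA _ _ _ _ ha hc
  have h2 := hB _ _ _ _ hb hd
  dsimp only
  rw [add_sub_add_comm, add_apply]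
  exact add_nonneg h1 h2

theorem MaxMonotone.comp_add_left {B : X → Set (Dual' X)} (hB : MaxMonotone B) (x₀ : X) :
    MaxMonotone fun y => B (x₀ + y) := by
  refine ⟨fun x y x' y' hx hy => by simpa using hB.1 _ _ _ _ hx hy, fun x x' h => ?_⟩
  refine hB.2 _ _ fun y y' hy => ?_
  have := h (y - x₀) y' (by simpa using hy)
  rwa [show x - (y - x₀) = x₀ + x - y by abel] at this

end Auxiliary

variable [NormedAddCommGroup X] [NormedSpace ℝ X] [CompleteSpace X]

theorem stmt9 (f : X → EReal) (hf : ProperFun f) (hlsc : LowerSemicontinuous f)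
    (hconv : EConvexOn f) (B : X → Set (Dual' X)) (hB : MaxMonotone B)
    (hfull : domOp B = Set.univ) :
    MaxMonotone (opSum (subdiff f) B) := by
  refine ⟨(monotoneOp_subdiff hf).opSum hB.1, fun x₀ x₀' hrel => ?_⟩
  obtain ⟨hbot, w, hw⟩ := hf
  let E : Set (X × ℝ) := {p | f (x₀ + p.1) ≤ ((p.2 + x₀' p.1 : ℝ) : EReal)}
  have hcl : IsClosed E := by
    refine hlsc.isClosed_epigraph.preimage
      (f := fun p : X × ℝ => (x₀ + p.1, ((p.2 + x₀' p.1 : ℝ) : EReal))) ?_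
    exact (by fun_prop : Continuous fun p : X × ℝ => x₀ + p.1).prodMk
      (continuous_coe_real_ereal.comp (by fun_prop))
  have hE : Convex ℝ E := by
    rintro ⟨x, a⟩ hx ⟨y, b⟩ hy s t hs ht hst
    obtain rfl : t = 1 - s := by linarith
    have h1 := hconv (x₀ + x) (x₀ + y) s hs (by linarith)
    have h2 : s • (x₀ + x) + (1 - s) • (x₀ + y) = x₀ + (s • x + (1 - s) • y) := by module
    rw [h2] at h1
    refine h1.trans ((add_le_add
      (mul_le_mul_of_nonneg_left (hx : f (x₀ + x) ≤ _) (EReal.coe_nonneg.2 hs))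
      (mul_le_mul_of_nonneg_left (hy : f (x₀ + y) ≤ _) (EReal.coe_nonneg.2 ht))).trans
      (le_of_eq ?_))
    rw [← EReal.coe_mul, ← EReal.coe_mul, ← EReal.coe_add]
    congr 1
    simp only [Prod.smul_mk, Prod.mk_add_mk, map_add, map_smul, smul_eq_mul]
    ring
  have hmem : ∀ y (r : ℝ), f y = r → (y - x₀, r - x₀' (y - x₀)) ∈ E := by
    intro y r hr
    simp only [E, mem_ofPred_eq, add_sub_cancel, hr, sub_add_cancel, le_refl]
  obtain ⟨r, hr⟩ : ∃ r : ℝ, f w = r := ⟨_, (EReal.coe_toReal hw (hbot w)).symm⟩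
  have hmin : ∃ (l : Dual' X) (c : ℝ), ∀ p ∈ E, l p.1 + c ≤ p.2 := by
    refine exists_affine_minorant hE hcl (hmem w r hr) (t := r - x₀' (w - x₀) - 1) ?_ (by linarith)
    simp only [E, mem_ofPred_eq, add_sub_cancel, hr, EReal.coe_le_coe_iff]
    linarith
  have hsub : ∀ z a (l : Dual' X), (z, a) ∈ E → (∀ p ∈ E, a + l (p.1 - z) ≤ p.2) →
      l + x₀' ∈ subdiff f (x₀ + z) := by
    intro z a l hz hl y
    by_cases hy : f y = ⊤
    · rw [hy]; exact le_top
    obtain ⟨s, hs⟩ : ∃ s : ℝ, f y = s := ⟨_, (EReal.coe_toReal hy (hbot y)).symm⟩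
    have h1 := hl _ (hmem y s hs)
    refine (add_le_add_right (hz : f (x₀ + z) ≤ _) _).trans ?_
    rw [hs, ← EReal.coe_add, EReal.coe_le_coe_iff]
    simp only [map_sub, map_add, add_apply] at h1 ⊢
    linarith
  obtain ⟨a, b, ha, hb, hab⟩ := exists_subgradient_zero_of_monotonically_related hE hcl
    ⟨_, hmem w r hr⟩ hmin (hB.comp_add_left x₀) (eq_univ_of_forall fun y => by
      have : x₀ + y ∈ domOp B := hfull ▸ mem_univ _
      exact this) (by
      intro z a l hz hl b hb
      have := hrel (x₀ + z) (l + x₀' + b) ⟨_, hsub z a l hz hl, b, hb, rfl⟩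
      simp only [map_sub, map_add, sub_apply, add_apply] at this ⊢
      linarith)
  have hsub₀ : -b + x₀' ∈ subdiff f x₀ := by
    rw [← add_zero x₀]
    refine hsub 0 a (-b) ha fun p hp => ?_
    have := hab p hp
    rw [sub_zero, neg_apply]
    linarith
  rw [add_zero] at hb
  exact ⟨_, hsub₀, b, hb, by simp⟩
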